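/- Suppose d ≥ n and the feature vectors x₁,…,x_n ∈ ℝ^d are pairwise orthogonal with ‖xᵢ‖² = β for all i (so the nonzero eigenvalues of H are all equal to λ₁ = β/n). Then for every batch size m ≥ 1, every step size η, and every t ≥ 0, mini-batch SGD satisfies the exact equality E[L(w_t)] = λ₁·g(m, η)^t·‖P(w₀ − w*)‖². -/

import Mathlib

open RealInnerProductSpace Finset

/-- The rank-one operator `u ↦ ⟪v, u⟫ v`. -/
noncomputable def rankOne {d : ℕ} (v : EuclideanSpace ℝ (Fin d)) :
    EuclideanSpace ℝ (Fin d) →ₗ[ℝ] EuclideanSpace ℝ (Fin d) where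
  toFun u := ⟪v, u⟫ • v
  map_add' a b := by simp [inner_add_right, add_smul]
  map_smul' c a := by simp [inner_smul_right, mul_smul]

/-- The sample covariance operator `H = (1/n) ∑ᵢ xᵢxᵢᵀ` as a linear map. -/
noncomputable def covOp {n d : ℕ} (x : Fin n → EuclideanSpace ℝ (Fin d)) :
    EuclideanSpace ℝ (Fin d) →ₗ[ℝ] EuclideanSpace ℝ (Fin d) :=
  (1 / (n : ℝ)) • ∑ i, rankOne (x i)

/-- Expected value of `φ` after `t` steps of the Markov chain defined by `step`,
where each step draws a mini-batch index tuple uniformly. -/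
noncomputable def sgdExp {H : Type*} (n m : ℕ) (step : (Fin m → Fin n) → H → H)
    (φ : H → ℝ) : ℕ → H → ℝ
  | 0 => φ
  | t + 1 => fun w => (1 / (n : ℝ) ^ m) * ∑ s : Fin m → Fin n, sgdExp n m step φ t (step s w)

/-- Second moment of an affine function of the multiplicity of `i` in a uniform index tuple. -/
lemma sum_sq_add_mul_count {n : ℕ} (i : Fin n) (m : ℕ) (p q : ℝ) :
    ∑ s : Fin m → Fin n, (p + q * ∑ j, if s j = i then (1 : ℝ) else 0) ^ 2
      = (n : ℝ) ^ m * ((p + q * m / n) ^ 2 + q ^ 2 * m / n * (1 - 1 / n)) := by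
  have hn : (n : ℝ) ≠ 0 := Nat.cast_ne_zero.mpr (Fin.pos i).ne'
  induction m generalizing p with
  | zero => simp
  | succ m ih =>
    rw [← (Fin.consEquiv fun _ : Fin (m + 1) => Fin n).sum_comp, Fintype.sum_prod_type]
    have hsplit : ∀ k : Fin n,
        ∑ s : Fin m → Fin n, (p + q * ∑ j, if (Fin.consEquiv fun _ : Fin (m + 1) => Fin n)
          (k, s) j = i then (1 : ℝ) else 0) ^ 2
        = ∑ s : Fin m → Fin n, ((p + if k = i then q else 0)
          + q * ∑ j, if s j = i then (1 : ℝ) else 0) ^ 2 := by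
      intro k
      refine Finset.sum_congr rfl fun s _ => ?_
      simp only [Fin.consEquiv_apply, Fin.sum_univ_succ, Fin.cons_zero, Fin.cons_succ]
      split_ifs <;> ring
    simp only [hsplit, ih]
    rw [← Finset.add_sum_erase _ _ (Finset.mem_univ i),
      Finset.sum_congr rfl fun k hk => by rw [if_neg (Finset.ne_of_mem_erase hk)],
      Finset.sum_const, Finset.card_erase_of_mem (Finset.mem_univ i), Finset.card_univ,
      Fintype.card_fin, nsmul_eq_mul, Nat.cast_pred (Fin.pos i), if_pos rfl]
    push_cast
    field_simp
    ring

/-- Gram identity for pairwise orthogonal vectors of equal norm. -/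
lemma inner_eq_ite_of_orthogonal {d n : ℕ} {x : Fin n → EuclideanSpace ℝ (Fin d)} {β : ℝ}
    (hnorm : ∀ i, ‖x i‖ ^ 2 = β) (horth : ∀ i j, i ≠ j → ⟪x i, x j⟫ = 0) (i k : Fin n) :
    ⟪x i, x k⟫ = if k = i then β else 0 := by
  split_ifs with h
  · rw [h, real_inner_self_eq_norm_sq, hnorm]
  · exact horth i k (Ne.symm h)

lemma covOp_apply {d n : ℕ} (x : Fin n → EuclideanSpace ℝ (Fin d))
    (u : EuclideanSpace ℝ (Fin d)) :
    covOp x u = (1 / (n : ℝ)) • ∑ i, ⟪x i, u⟫ • x i := by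
  simp [covOp, rankOne]

/-- Up to the factor `β`, the projection onto the range of the covariance operator has squared
norm equal to the sum of the squared correlations with the features. -/
lemma mul_norm_sq_proj_range_covOp {d n : ℕ} {x : Fin n → EuclideanSpace ℝ (Fin d)} {β : ℝ}
    (hgram : ∀ i k, ⟪x i, x k⟫ = if k = i then β else 0) {u p : EuclideanSpace ℝ (Fin d)}
    (hp : p ∈ LinearMap.range (covOp x)) (hup : u - p ∈ (LinearMap.range (covOp x))ᗮ) :
    β * ‖p‖ ^ 2 = ∑ i, ⟪x i, u⟫ ^ 2 := by
  have horth : ∀ v, ⟪covOp x v, u - p⟫ = 0 := fun v =>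
    (Submodule.mem_orthogonal _ _).mp hup _ (LinearMap.mem_range_self _ v)
  obtain ⟨v, rfl⟩ := hp
  have hcov : ∀ i, ⟪x i, covOp x v⟫ = β / n * ⟪x i, v⟫ := by
    intro i
    simp [covOp_apply, inner_smul_right, inner_sum, hgram]
    ring
  have hx : ∀ i, ⟪x i, u⟫ = β / n * ⟪x i, v⟫ := by
    intro i
    have hn : (n : ℝ) ≠ 0 := Nat.cast_ne_zero.mpr (Fin.pos i).ne'
    rcases eq_or_ne β 0 with rfl | hβ
    · have : x i = 0 := by
        rw [← inner_self_eq_zero (𝕜 := ℝ), hgram, if_pos rfl]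
      simp [this]
    · have h := horth (x i)
      have hxi : covOp x (x i) = (β / n) • x i := by
        simp [covOp_apply, hgram, smul_smul]
        ring_nf
      rw [hxi, real_inner_smul_left, inner_sub_right, hcov] at h
      have := (mul_eq_zero.mp h).resolve_left (div_ne_zero hβ hn)
      linarith
  have hsq : ‖covOp x v‖ ^ 2 = ⟪covOp x v, u⟫ := by
    rw [← real_inner_self_eq_norm_sq]
    have := horth v
    rw [inner_sub_right] at this
    linarith
  rw [hsq, covOp_apply, real_inner_smul_left, sum_inner, Finset.mul_sum, Finset.mul_sum]
  refine Finset.sum_congr rfl fun i _ => ?_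
  rw [real_inner_smul_left, hx]
  ring

/-- Tightness: if `d ≥ n` and the feature vectors are pairwise orthogonal with
`‖xᵢ‖² = β` (so the nonzero eigenvalues of `H` all equal `λ₁ = β/n`), then for every
batch size, step size and `t`, mini-batch SGD satisfies the exact equality
`E[L(w_t)] = λ₁·g(m,η)^t·‖P(w₀ − w*)‖²` with
`g(m,η) = (1 − ηλ₁)² + (η²λ₁/m)(β − λ₁)`. -/
theorem quadratic_sgd_lower_bound_tightness
    (d n : ℕ) (hn : 1 ≤ n) (hd : n ≤ d)
    (x : Fin n → EuclideanSpace ℝ (Fin d)) (y : Fin n → ℝ)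
    (β : ℝ)
    (hnorm : ∀ i, ‖x i‖ ^ 2 = β)
    (horth : ∀ i j, i ≠ j → ⟪x i, x j⟫ = 0)
    (wstar : EuclideanSpace ℝ (Fin d)) (hinterp : ∀ i, ⟪wstar, x i⟫ = y i)
    (L : EuclideanSpace ℝ (Fin d) → ℝ)
    (hL : ∀ w, L w = (1 / (n : ℝ)) * ∑ i, (⟪w, x i⟫ - y i) ^ 2)
    -- P is the orthogonal projection onto Range(H)
    (P : EuclideanSpace ℝ (Fin d) → EuclideanSpace ℝ (Fin d))
    (hPmem : ∀ u, P u ∈ LinearMap.range (covOp x))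
    (hPorth : ∀ u, u - P u ∈ (LinearMap.range (covOp x))ᗮ)
    (m : ℕ) (hm : 1 ≤ m) (η : ℝ)
    (step : (Fin m → Fin n) → EuclideanSpace ℝ (Fin d) → EuclideanSpace ℝ (Fin d))
    (hstep : ∀ s w, step s w
      = w - η • ((1 / (m : ℝ)) • ∑ j, ⟪x (s j), w - wstar⟫ • x (s j)))
    (w0 : EuclideanSpace ℝ (Fin d)) :
    ∀ t : ℕ,
      sgdExp n m step L t w0
        = (β / (n : ℝ)) *
            ((1 - η * (β / (n : ℝ))) ^ 2
              + η ^ 2 * (β / (n : ℝ)) / (m : ℝ) * (β - β / (n : ℝ))) ^ t *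
            ‖P (w0 - wstar)‖ ^ 2 := by
  have hn0 : (n : ℝ) ≠ 0 := Nat.cast_ne_zero.mpr (by omega)
  have hm0 : (m : ℝ) ≠ 0 := Nat.cast_ne_zero.mpr (by omega)
  have hgram := inner_eq_ite_of_orthogonal hnorm horth
  have hloss : ∀ w, L w = (1 / (n : ℝ)) * ∑ i, ⟪x i, w - wstar⟫ ^ 2 := by
    intro w
    rw [hL]
    congr 1
    refine Finset.sum_congr rfl fun i _ => ?_
    rw [← hinterp, ← inner_sub_left, real_inner_comm]
  have hcoord : ∀ s w i, ⟪x i, step s w - wstar⟫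
      = ⟪x i, w - wstar⟫ * (1 + -(η * β / m) * ∑ j, if s j = i then (1 : ℝ) else 0) := by
    intro s w i
    rw [hstep, sub_right_comm, inner_sub_right, inner_smul_right, inner_smul_right, inner_sum]
    have : ∀ j, ⟪x i, ⟪x (s j), w - wstar⟫ • x (s j)⟫
        = β * ⟪x i, w - wstar⟫ * if s j = i then (1 : ℝ) else 0 := by
      intro j
      rw [inner_smul_right, hgram]
      split_ifs with h
      · rw [h]; ring
      · simp
    simp only [this, ← Finset.mul_sum]
    ring
  set g := (1 - η * (β / (n : ℝ))) ^ 2 + η ^ 2 * (β / (n : ℝ)) / (m : ℝ) * (β - β / (n : ℝ))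
    with hg
  have hmean : ∀ w, (1 / (n : ℝ) ^ m) * ∑ s, L (step s w) = g * L w := by
    intro w
    simp only [hloss, hcoord, mul_pow]
    rw [← Finset.mul_sum, Finset.sum_comm]
    simp only [← Finset.mul_sum, sum_sq_add_mul_count]
    rw [← Finset.sum_mul, hg]
    field_simp
    ring
  have hpow : ∀ t w, sgdExp n m step L t w = g ^ t * L w := by
    intro t
    induction t with
    | zero => intro w; simp [sgdExp]
    | succ t ih =>
      intro w
      simp only [sgdExp, ih]
      rw [← Finset.mul_sum, mul_left_comm, hmean]
      ring
  intro t
  rw [hpow, hloss, ← mul_norm_sq_proj_range_covOp hgram (hPmem _) (hPorth _)]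
  ring
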